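/- Let $T$ be a tree on a finite vertex set $V$ with $|V| = n \geq 1$, and let $k \geq 1$ be an integer. Then there exist an integer $m$ with $1 \leq m \leq k$ and nonempty subsets $S_1, \ldots, S_m \subseteq V$ such that $S_1 \cup \cdots \cup S_m = V$, for each $i$ the subgraph of $T$ induced on $S_i$ is connected, and for each $i$ one has $|S_i| \leq 2n/k + 1$ (as an inequality of real numbers). -/

import Mathlib

/-- Vertex sets built by hanging rooted pieces from one another along edges. -/
inductive RootedBuild {V : Type*} [DecidableEq V] (T : SimpleGraph V) : V → Finset V → Prop
  | single (r : V) : RootedBuild T r {r}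
  | merge {r c : V} {A B : Finset V} : RootedBuild T r A → RootedBuild T c B → T.Adj r c →
      Disjoint A B → RootedBuild T r (A ∪ B)

theorem RootedBuild.grow {V : Type*} [DecidableEq V] {T : SimpleGraph V} {r : V} {A : Finset V}
    (h : RootedBuild T r A) : ∀ a ∈ A, ∀ v, v ∉ A → T.Adj a v → RootedBuild T r (insert v A) := by
  induction h with
  | single r =>
    intro a ha v hv hav
    obtain rfl : a = r := by simpa using ha
    have := RootedBuild.merge (.single a) (.single v) hav (by simpa [eq_comm] using hv)
    rwa [Finset.union_comm] at this
  | @merge r c A B hA hB hrc hd ihA ihB =>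
    intro a ha v hv hav
    rw [Finset.mem_union, not_or] at hv
    rcases Finset.mem_union.1 ha with ha | ha
    · rw [← Finset.insert_union]
      exact .merge (ihA a ha v hv.1 hav) hB hrc (Finset.disjoint_insert_left.2 ⟨hv.2, hd⟩)
    · rw [← Finset.union_insert]
      exact .merge hA (ihB a ha v hv.2 hav) hrc (Finset.disjoint_insert_right.2 ⟨hv.1, hd⟩)

theorem RootedBuild.exists_univ {V : Type*} [Fintype V] [DecidableEq V] {T : SimpleGraph V}
    (hT : T.Connected) (r : V) : RootedBuild T r Finset.univ := by
  have key : ∀ d : ℕ, ∀ A : Finset V, A.Nonempty → Fintype.card V - A.card = d →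
      RootedBuild T r A → RootedBuild T r Finset.univ := by
    intro d
    induction d with
    | zero =>
      intro A _ hc hA
      have : A = Finset.univ := by
        apply (Finset.card_eq_iff_eq_univ A).1
        have := Finset.card_le_univ A
        omega
      rwa [← this]
    | succ d ih =>
      rintro A ⟨a, ha⟩ hc hA
      have : ∃ v, v ∉ A := by
        by_contra! h
        have : A = Finset.univ := by ext v; simp [h v]
        subst this
        simp at hc
      obtain ⟨v, hv⟩ := this
      obtain ⟨p⟩ := hT.preconnected a v
      obtain ⟨e, -, h1, h2⟩ := p.exists_boundary_dart (A : Set V) (by simpa using ha)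
        (by simpa using hv)
      have h1' : e.fst ∈ A := by simpa using h1
      have h2' : e.snd ∉ A := by simpa using h2
      refine ih (insert e.snd A) (Finset.insert_nonempty _ _) ?_ (hA.grow _ h1' _ h2' e.adj)
      rw [Finset.card_insert_of_notMem h2']
      omega
  exact key _ {r} (Finset.singleton_nonempty r) rfl (.single r)

theorem RootedBuild.decompose {V : Type*} [DecidableEq V] {T : SimpleGraph V} {r : V}
    {A : Finset V} (x : ℝ) (hx : 1 ≤ x) (h : RootedBuild T r A) :
    ∃ (L : List (Finset V)) (R : Finset V), r ∈ R ∧ (T.induce (R : Set V)).Connected ∧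
      (R.card : ℝ) < x + 1 ∧
      (∀ P ∈ L, (T.induce (P : Set V)).Connected ∧ (P.card : ℝ) ≤ 2 * x + 1) ∧
      (∀ v ∈ A, v ∈ R ∨ ∃ P ∈ L, v ∈ P) ∧
      (L.length : ℝ) * x + R.card ≤ A.card := by
  have single_conn : ∀ r : V, (T.induce (({r} : Finset V) : Set V)).Connected := by
    intro r
    rw [Finset.coe_singleton]
    haveI : Nonempty ({r} : Set V) := ⟨⟨r, rfl⟩⟩
    exact ⟨SimpleGraph.Preconnected.of_subsingleton⟩
  induction h with
  | single r =>
    refine ⟨[], {r}, by simp, single_conn r, ?_, by simp, by simp, by simp⟩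
    simp; linarith
  | @merge r c A B hA hB hrc hd ihA ihB =>
    obtain ⟨LA, RA, hrA, cA, sA, pA, covA, bA⟩ := ihA
    obtain ⟨LB, RB, hrB, cB, sB, pB, covB, bB⟩ := ihB
    have hcard : ((A ∪ B).card : ℝ) = A.card + B.card := by
      rw [Finset.card_union_of_disjoint hd]; push_cast; rfl
    have hpAB : ∀ P ∈ LA ++ LB, (T.induce (P : Set V)).Connected ∧ (P.card : ℝ) ≤ 2 * x + 1 := by
      intro P hP
      rcases List.mem_append.1 hP with h | h
      exacts [pA P h, pB P h]
    have hun : ((RA ∪ RB).card : ℝ) ≤ RA.card + RB.card := by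
      exact_mod_cast Finset.card_union_le RA RB
    have cU : (T.induce ((RA ∪ RB : Finset V) : Set V)).Connected := by
      rw [Finset.coe_union]
      exact SimpleGraph.connected_induce_union cA.preconnected cB.preconnected
        (by simpa using hrA) (by simpa using hrB) hrc
    by_cases h1 : x ≤ RB.card
    · refine ⟨({r} ∪ RB) :: (LA ++ LB), RA, hrA, cA, sA, ?_, ?_, ?_⟩
      · intro P hP
        rcases List.mem_cons.1 hP with rfl | h
        · constructor
          · rw [Finset.coe_union]
            exact SimpleGraph.connected_induce_union (single_conn r).preconnected cB.preconnected
              (by simp) (by simpa using hrB) hrc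
          · have : (({r} ∪ RB).card : ℝ) ≤ 1 + RB.card := by
              exact_mod_cast Finset.card_union_le {r} RB
            linarith
        · exact hpAB P h
      · intro v hv
        have := covA v
        have := covB v
        simp only [List.mem_cons, List.mem_append, Finset.mem_union] at *
        grind
      · simp only [List.length_cons, List.length_append]
        push_cast
        rw [hcard]; linarith
    · push Not at h1
      by_cases h2 : (RA.card : ℝ) + RB.card < x + 1
      · refine ⟨LA ++ LB, RA ∪ RB, by simp [hrA], cU, by linarith, hpAB, ?_, ?_⟩
        · intro v hv
          have := covA v
          have := covB v
          simp only [List.mem_append, Finset.mem_union] at *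
          grind
        · simp only [List.length_append]
          push_cast
          rw [hcard]; linarith
      · push Not at h2
        refine ⟨(RA ∪ RB) :: (LA ++ LB), {r}, by simp, single_conn r, ?_, ?_, ?_, ?_⟩
        · simp; linarith
        · intro P hP
          rcases List.mem_cons.1 hP with rfl | h
          · exact ⟨cU, by linarith⟩
          · exact hpAB P h
        · intro v hv
          have := covA v
          have := covB v
          simp only [List.mem_cons, List.mem_append, Finset.mem_union] at *
          grind
        · simp only [List.length_cons, List.length_append, Finset.card_singleton]
          push_cast
          rw [hcard]; linarith

/-- **Sector decomposition of a tree.** If `T` is a tree on a finite vertex set `V` with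
`|V| = n ≥ 1` and `k ≥ 1` is an integer, then there exist `m` with `1 ≤ m ≤ k` and
nonempty subsets `S 1, …, S m ⊆ V` covering `V`, each inducing a connected subgraph of
`T`, and each of size at most `2n/k + 1` (as real numbers). -/
theorem tree_sector_decomposition {V : Type*} [Fintype V] [DecidableEq V]
    (T : SimpleGraph V) (hconn : T.Connected) (hacyc : T.IsAcyclic)
    (n k : ℕ) (hn : Fintype.card V = n) (hn1 : 1 ≤ n) (hk : 1 ≤ k) :
    ∃ (m : ℕ) (S : Fin m → Finset V), 1 ≤ m ∧ m ≤ k ∧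
      (∀ i, (S i).Nonempty) ∧
      (∀ v : V, ∃ i, v ∈ S i) ∧
      (∀ i, (T.induce ((S i : Finset V) : Set V)).Connected) ∧
      (∀ i, ((S i).card : ℝ) ≤ 2 * n / k + 1) := by
  have hn0 : (0 : ℝ) < n := by exact_mod_cast hn1
  have hk0 : (0 : ℝ) < k := by exact_mod_cast hk
  by_cases hkn : k ≤ n
  · obtain ⟨r⟩ := hconn.nonempty
    have hx : (1 : ℝ) ≤ n / k := by
      rw [le_div_iff₀ hk0]; simpa using (by exact_mod_cast hkn : (k : ℝ) ≤ n)
    obtain ⟨L, R, hr, cR, sR, pL, cov, hb⟩ :=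
      (RootedBuild.exists_univ hconn r).decompose ((n : ℝ) / k) hx
    have hall : ∀ P ∈ R :: L, (T.induce (P : Set V)).Connected ∧
        (P.card : ℝ) ≤ 2 * n / k + 1 := by
      intro P hP
      rw [mul_div_assoc]
      rcases List.mem_cons.1 hP with rfl | h
      · exact ⟨cR, by linarith⟩
      · exact pL P h
    refine ⟨(R :: L).length, fun i => (R :: L).get i, by simp, ?_, ?_, ?_, ?_, ?_⟩
    · have hR : (1 : ℝ) ≤ R.card := by
        exact_mod_cast Finset.card_pos.2 ⟨r, hr⟩
      rw [Finset.card_univ, hn] at hb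
      have h1 : (L.length : ℝ) * (n / k) < k * (n / k) := by
        have : (k : ℝ) * (n / k) = n := by field_simp
        linarith
      have h2 : (L.length : ℝ) < k := lt_of_mul_lt_mul_right h1 (by linarith)
      have h3 : L.length < k := by exact_mod_cast h2
      simpa using h3
    · intro i
      obtain ⟨⟨v, hv⟩⟩ := (hall _ (List.get_mem _ i)).1.nonempty
      exact ⟨v, by simpa using hv⟩
    · intro v
      have : ∃ P ∈ R :: L, v ∈ P := by
        have := cov v (Finset.mem_univ v)
        simpa using this
      obtain ⟨P, hP, hv⟩ := this
      obtain ⟨i, rfl⟩ := List.get_of_mem hP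
      exact ⟨i, hv⟩
    · exact fun i => (hall _ (List.get_mem _ i)).1
    · exact fun i => (hall _ (List.get_mem _ i)).2
  · refine ⟨n, fun i => {(Fintype.equivFinOfCardEq hn).symm i}, hn1, by omega, by simp, ?_, ?_, ?_⟩
    · exact fun v => ⟨Fintype.equivFinOfCardEq hn v, by simp⟩
    · intro i
      rw [Finset.coe_singleton]
      haveI : Nonempty ({(Fintype.equivFinOfCardEq hn).symm i} : Set V) := ⟨⟨_, rfl⟩⟩
      exact ⟨SimpleGraph.Preconnected.of_subsingleton⟩
    · intro i
      have : (0 : ℝ) ≤ 2 * n / k := by positivity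
      simp only [Finset.card_singleton, Nat.cast_one]
      linarith
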